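/- arXiv:1302.0207 — 2 statements merged into one kernel-verified Lean document; each statement's English description precedes it below -/
import Mathlib

section
/- Let G be a finite connected simple graph. Then the toric ideal I_G is generated by the set of binomials { f_Γ : Γ an even closed walk of G }. -/
set_option linter.unusedVariables false

open MvPolynomial

universe uv

/-- The monomial `t_a t_b` associated to an edge `{a,b}`. -/
noncomputable def edgeMon {V : Type*} (K : Type*) [Field K] (e : Sym2 V) :
    MvPolynomial V K :=
  Sym2.lift ⟨fun a b => X a * X b, fun _ _ => mul_comm _ _⟩ e

/-- The toric ideal `I_G` of a graph `G`: the kernel of the `K`-algebra map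
`K[x_e : e ∈ E(G)] → K[t_v : v ∈ V]`, `x_e ↦ t_a t_b` for `e = {a,b}`. -/
noncomputable def toricIdeal {V : Type*} (K : Type*) [Field K] (G : SimpleGraph V) :
    Ideal (MvPolynomial G.edgeSet K) :=
  RingHom.ker (MvPolynomial.aeval (R := K) (fun e : G.edgeSet => edgeMon K e.1))

/-- The binomial `f_Γ` attached to an even closed walk `w` of length `2q`:
the product of the odd-position edge variables minus the product of the
even-position edge variables. -/
noncomputable def walkBinomial {V K : Type*} [Field K] {G : SimpleGraph V} {v : V}
    (w : G.Walk v v) (q : ℕ) (hq : w.length = 2 * q) : MvPolynomial G.edgeSet K :=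
  (∏ k : Fin q, X (⟨w.edges[2 * (k : ℕ)]'(by
      rw [SimpleGraph.Walk.length_edges, hq]; omega),
      w.edges_subset_edgeSet (List.getElem_mem _)⟩ : G.edgeSet))
  - ∏ k : Fin q, X (⟨w.edges[2 * (k : ℕ) + 1]'(by
      rw [SimpleGraph.Walk.length_edges, hq]; omega),
      w.edges_subset_edgeSet (List.getElem_mem _)⟩ : G.edgeSet)

theorem edgeMon_mk {V K : Type*} [Field K] (a b : V) :
    edgeMon K s(a, b) = X a * X b :=
  rfl

theorem Sym2.toMultiset_mk {V : Type*} (a b : V) : s(a, b).toMultiset = {a, b} :=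
  rfl

/-- The multiset of vertices covered by a multiset of edges. -/
noncomputable def edgeDeg {V : Type*} {G : SimpleGraph V} (s : Multiset G.edgeSet) :
    Multiset V :=
  s.bind fun e => e.1.toMultiset

/-- The product of the edge variables in the positions `2k + i`, `k < q`, of a walk. -/
noncomputable def walkProd {V : Type*} (K : Type*) [Field K] {G : SimpleGraph V} {u v : V}
    (w : G.Walk u v) (q : ℕ) (hq : w.length = 2 * q) (i : Fin 2) : MvPolynomial G.edgeSet K :=
  ∏ k : Fin q, X (⟨w.edges[2 * (k : ℕ) + i]'(by
      rw [SimpleGraph.Walk.length_edges, hq]; omega),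
      w.edges_subset_edgeSet (List.getElem_mem _)⟩ : G.edgeSet)

section

variable {V K : Type*} [Field K] {G : SimpleGraph V}

theorem walkBinomial_eq_sub {v : V} (w : G.Walk v v) (q : ℕ) (hq : w.length = 2 * q) :
    walkBinomial (K := K) w q hq = walkProd K w q hq 0 - walkProd K w q hq 1 :=
  rfl

theorem walkProd_zero {u v : V} (w : G.Walk u v) (hq : w.length = 2 * 0) (i : Fin 2) :
    walkProd K w 0 hq i = 1 := by
  simp [walkProd]

theorem walkProd_nil (v : V) (i : Fin 2) :
    walkProd K (.nil : G.Walk v v) 0 (by simp) i = 1 :=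
  walkProd_zero _ _ i

theorem walkProd_cons_cons_zero {a b c d : V} (h : G.Adj a b) (h' : G.Adj b c) (w : G.Walk c d)
    (q : ℕ) (hq : w.length = 2 * q)
    (hq' : (SimpleGraph.Walk.cons h (SimpleGraph.Walk.cons h' w)).length = 2 * (q + 1)) :
    walkProd K (.cons h (.cons h' w)) (q + 1) hq' 0 =
      X ⟨s(a, b), h⟩ * walkProd K w q hq 0 := by
  simp [walkProd, Fin.prod_univ_succ, mul_add]

theorem walkProd_cons_cons_one {a b c d : V} (h : G.Adj a b) (h' : G.Adj b c) (w : G.Walk c d)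
    (q : ℕ) (hq : w.length = 2 * q)
    (hq' : (SimpleGraph.Walk.cons h (SimpleGraph.Walk.cons h' w)).length = 2 * (q + 1)) :
    walkProd K (.cons h (.cons h' w)) (q + 1) hq' 1 =
      X ⟨s(b, c), h'⟩ * walkProd K w q hq 1 := by
  simp [walkProd, Fin.prod_univ_succ, mul_add]

/-- The images of the two products of an even walk differ by the end points of the walk. -/
theorem aeval_walkProd_mul_X (q : ℕ) : ∀ {u v : V} (w : G.Walk u v) (hq : w.length = 2 * q),
    aeval (R := K) (fun e : G.edgeSet => edgeMon K e.1) (walkProd K w q hq 0) * X v =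
      aeval (R := K) (fun e : G.edgeSet => edgeMon K e.1) (walkProd K w q hq 1) * X u := by
  induction q with
  | zero =>
    intro u v w hq
    obtain rfl := SimpleGraph.Walk.eq_of_length_eq_zero hq
    simp [walkProd_zero]
  | succ q ih =>
    intro u v w hq
    match w, hq with
    | .nil, hq => simp at hq
    | .cons h .nil, hq => simp at hq; omega
    | .cons (v := b) h (.cons h' w), hq =>
      have hw : w.length = 2 * q := by simp at hq; omega
      rw [walkProd_cons_cons_zero h h' w q hw, walkProd_cons_cons_one h h' w q hw]
      simp only [map_mul, aeval_X, edgeMon_mk]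
      linear_combination X u * X b * ih w hw

theorem exists_mem_of_mem_edgeDeg {s : Multiset G.edgeSet} {b : V} (hb : b ∈ edgeDeg s) :
    ∃ (c : V) (h : G.Adj b c) (s' : Multiset G.edgeSet), s = ⟨s(b, c), h⟩ ::ₘ s' := by
  obtain ⟨⟨e, he⟩, hes, hbe⟩ := Multiset.mem_bind.1 hb
  obtain ⟨c, rfl⟩ := (Sym2.mem_toMultiset.1 hbe : b ∈ e)
  obtain ⟨s', hs'⟩ := Multiset.exists_cons_of_mem hes
  exact ⟨c, he, s', hs'⟩

theorem edgeDeg_cons {b c : V} (h : G.Adj b c) (s : Multiset G.edgeSet) :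
    edgeDeg (⟨s(b, c), h⟩ ::ₘ s) = b ::ₘ c ::ₘ edgeDeg s := by
  simp [edgeDeg, Sym2.toMultiset_mk]

theorem card_edgeDeg (s : Multiset G.edgeSet) : (edgeDeg s).card = 2 * s.card := by
  simp [edgeDeg, Multiset.card_bind, Sym2.card_toMultiset, mul_comm]

/-- A pair of multisets of edges whose vertex degrees differ by `b - a` admits two edges with
which an alternating walk starting at `b` can be prolonged. -/
theorem exists_alternating_step {s t : Multiset G.edgeSet} {a b : V}
    (h : a ::ₘ edgeDeg s = b ::ₘ edgeDeg t) (hb : b ∈ edgeDeg s) :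
    ∃ (c d : V) (hdc : G.Adj d c) (hcb : G.Adj c b) (s' t' : Multiset G.edgeSet),
      s = ⟨s(c, b), hcb⟩ ::ₘ s' ∧ t = ⟨s(d, c), hdc⟩ ::ₘ t' ∧
      a ::ₘ edgeDeg s' = d ::ₘ edgeDeg t' := by
  obtain ⟨c, hbc, s', rfl⟩ := exists_mem_of_mem_edgeDeg hb
  rw [edgeDeg_cons, Multiset.cons_swap, Multiset.cons_inj_right, Multiset.cons_swap] at h
  obtain ⟨d, hcd, t', rfl⟩ := exists_mem_of_mem_edgeDeg (h ▸ Multiset.mem_cons_self c _)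
  rw [edgeDeg_cons, Multiset.cons_inj_right] at h
  exact ⟨c, d, hcd.symm, hbc.symm, s', t', by simp [Sym2.eq_swap], by simp [Sym2.eq_swap], h⟩

/-- The ideal generated by the binomials of the even closed walks. -/
noncomputable def walkIdeal (K : Type*) [Field K] (G : SimpleGraph V) :
    Ideal (MvPolynomial G.edgeSet K) :=
  Ideal.span { f : MvPolynomial G.edgeSet K |
    ∃ (v : V) (w : G.Walk v v) (q : ℕ) (hq : w.length = 2 * q), f = walkBinomial w q hq }

theorem sub_walkProd_mem_walkIdeal {v : V} (w : G.Walk v v) (q : ℕ) (hq : w.length = 2 * q) :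
    walkProd K w q hq 0 - walkProd K w q hq 1 ∈ walkIdeal K G :=
  Ideal.subset_span ⟨v, w, q, hq, rfl⟩

/-- Completing an even walk by two multisets of edges that balance its end points gives a
binomial in the ideal of the even closed walks. -/
theorem walkProd_mul_sub_mem_walkIdeal (n : ℕ) : ∀ (s t : Multiset G.edgeSet) {a b : V}
    (w : G.Walk b a) (q : ℕ) (hq : w.length = 2 * q), s.card = n →
    a ::ₘ edgeDeg s = b ::ₘ edgeDeg t →
    walkProd K w q hq 0 * (t.map X).prod - walkProd K w q hq 1 * (s.map X).prod
      ∈ walkIdeal K G := by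
  induction n with
  | zero =>
    intro s t a b w q hq hs h
    have hst := congrArg Multiset.card h
    rw [Multiset.card_cons, Multiset.card_cons, card_edgeDeg, card_edgeDeg, hs] at hst
    obtain rfl := Multiset.card_eq_zero.1 hs
    obtain rfl : t = 0 := Multiset.card_eq_zero.1 (by omega)
    obtain rfl : a = b := by simpa [edgeDeg] using h
    simpa using sub_walkProd_mem_walkIdeal (K := K) w q hq
  | succ n ih =>
    intro s t a b w q hq hs h
    by_cases hb : b ∈ edgeDeg s
    · obtain ⟨c, d, hdc, hcb, s', t', rfl, rfl, h'⟩ := exists_alternating_step h hb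
      have hlen : (SimpleGraph.Walk.cons hdc (.cons hcb w)).length = 2 * (q + 1) := by
        simp; omega
      have := ih s' t' (.cons hdc (.cons hcb w)) (q + 1) hlen (by simpa using hs) h'
      rw [walkProd_cons_cons_zero hdc hcb w q hq, walkProd_cons_cons_one hdc hcb w q hq] at this
      simp only [Multiset.map_cons, Multiset.prod_cons]
      convert this using 1
      ring
    · obtain rfl : b = a := by
        have : b ∈ a ::ₘ edgeDeg s := h ▸ Multiset.mem_cons_self b _
        exact (Multiset.mem_cons.1 this).resolve_right hb
      have hclosed : walkProd K w q hq 0 - walkProd K w q hq 1 ∈ walkIdeal K G :=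
        sub_walkProd_mem_walkIdeal w q hq
      obtain ⟨x, hx⟩ : ∃ x, x ∈ edgeDeg s :=
        Multiset.card_pos_iff_exists_mem.1 (by rw [card_edgeDeg]; omega)
      obtain ⟨c, d, hdc, hcx, s', t', rfl, rfl, h'⟩ := exists_alternating_step
        (congrArg (x ::ₘ ·) ((Multiset.cons_inj_right b).1 h)) hx
      have := ih s' t' (.cons hdc (.cons hcx .nil)) (0 + 1) (by simp) (by simpa using hs) h'
      rw [walkProd_cons_cons_zero hdc hcx .nil 0 (by simp),
        walkProd_cons_cons_one hdc hcx .nil 0 (by simp), walkProd_nil, walkProd_nil] at this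
      simp only [Multiset.map_cons, Multiset.prod_cons]
      convert add_mem (Ideal.mul_mem_left _ (walkProd K w q hq 0) this) (Ideal.mul_mem_left _
        (X ⟨s(c, x), hcx⟩ * (s'.map X).prod) hclosed) using 1
      ring

/-- Monomials covering the same vertices are congruent modulo the walk binomials. -/
theorem prod_X_sub_prod_X_mem_walkIdeal {s t : Multiset G.edgeSet}
    (h : edgeDeg s = edgeDeg t) : (t.map X).prod - (s.map X).prod ∈ walkIdeal K G := by
  rcases Multiset.empty_or_exists_mem (edgeDeg s) with hs | ⟨a, -⟩
  · have hs' := card_edgeDeg s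
    have ht' := card_edgeDeg t
    rw [← h] at ht'
    rw [hs, Multiset.card_zero] at hs' ht'
    obtain rfl : s = 0 := Multiset.card_eq_zero.1 (by omega)
    obtain rfl : t = 0 := Multiset.card_eq_zero.1 (by omega)
    simp
  · have := walkProd_mul_sub_mem_walkIdeal (K := K) s.card s t
      (.nil : G.Walk a a) 0 (by simp) rfl (congrArg (a ::ₘ ·) h)
    rwa [walkProd_nil, walkProd_nil, one_mul, one_mul] at this

theorem edgeMon_eq_prod (e : Sym2 V) : edgeMon K e = (e.toMultiset.map X).prod := by
  induction e with
  | _ a b => simp [edgeMon_mk, Sym2.toMultiset_mk]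

theorem prod_X_eq_monomial {σ : Type*} (u : σ →₀ ℕ) :
    ((Finsupp.toMultiset u).map X).prod = monomial (R := K) u 1 := by
  rw [Finsupp.toMultiset_map, Finsupp.prod_toMultiset, monomial_eq]
  simp [Finsupp.prod_mapDomain_index, pow_add]

theorem aeval_edgeMon_monomial (u : G.edgeSet →₀ ℕ) :
    aeval (R := K) (fun e : G.edgeSet => edgeMon K e.1) (monomial u 1) =
      ((edgeDeg (Finsupp.toMultiset u)).map X).prod := by
  rw [← prod_X_eq_monomial, map_multiset_prod, Multiset.map_map, edgeDeg, Multiset.map_bind,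
    Multiset.prod_bind]
  simp [edgeMon_eq_prod]

theorem toricIdeal_le_walkIdeal (K : Type*) [Field K] (G : SimpleGraph V) :
    toricIdeal K G ≤ walkIdeal K G := by
  classical
  let deg : (G.edgeSet →₀ ℕ) → (V →₀ ℕ) := fun u =>
    Multiset.toFinsupp (edgeDeg (Finsupp.toMultiset u))
  let σ : MvPolynomial V K →ₗ[K] MvPolynomial G.edgeSet K ⧸ walkIdeal K G :=
    (basisMonomials V K).constr K fun m =>
      Ideal.Quotient.mk _ (monomial (Function.invFun deg m) 1)
  have hσ : σ ∘ₗ (aeval (R := K) (fun e : G.edgeSet => edgeMon K e.1)).toLinearMap =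
      (Ideal.Quotient.mkₐ K (walkIdeal K G)).toLinearMap := by
    refine (basisMonomials G.edgeSet K).ext fun u => ?_
    have hdeg : deg (Function.invFun deg (deg u)) = deg u := Function.invFun_eq ⟨u, rfl⟩
    have himage : aeval (R := K) (fun e : G.edgeSet => edgeMon K e.1) (monomial u 1) =
        basisMonomials V K (deg u) := by
      rw [aeval_edgeMon_monomial, coe_basisMonomials]
      simp only [deg, ← prod_X_eq_monomial, Multiset.toFinsupp_toMultiset]
    simp only [LinearMap.comp_apply, AlgHom.toLinearMap_apply]
    rw [coe_basisMonomials, himage, Module.Basis.constr_basis, Ideal.Quotient.mkₐ_eq_mk,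
      Ideal.Quotient.eq]
    simp only [← prod_X_eq_monomial]
    exact prod_X_sub_prod_X_mem_walkIdeal (Multiset.toFinsupp.injective hdeg).symm
  intro p hp
  have hp0 : aeval (R := K) (fun e : G.edgeSet => edgeMon K e.1) p = 0 := hp
  have := LinearMap.congr_fun hσ p
  simp only [LinearMap.comp_apply, AlgHom.toLinearMap_apply, hp0, map_zero] at this
  exact Ideal.Quotient.eq_zero_iff_mem.1 this.symm

theorem walkIdeal_le_toricIdeal (K : Type*) [Field K] (G : SimpleGraph V) :
    walkIdeal K G ≤ toricIdeal K G := by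
  refine Ideal.span_le.2 ?_
  rintro _ ⟨v, w, q, hq, rfl⟩
  change aeval (R := K) (fun e : G.edgeSet => edgeMon K e.1) _ = 0
  rw [walkBinomial_eq_sub, map_sub, sub_eq_zero]
  exact mul_right_cancel₀ (X_ne_zero v) (aeval_walkProd_mul_X q w hq)

end

/-- The toric ideal of a finite connected simple graph is generated by the binomials
`f_Γ`, where `Γ` runs over the even closed walks of `G`. -/
theorem toricIdeal_eq_span_walkBinomials {V : Type*} [Fintype V] (K : Type*) [Field K]
    (G : SimpleGraph V) (hG : G.Connected) :
    toricIdeal K G = Ideal.span { f : MvPolynomial G.edgeSet K |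
      ∃ (v : V) (w : G.Walk v v) (q : ℕ) (hq : w.length = 2 * q),
        f = walkBinomial w q hq } :=
  le_antisymm (toricIdeal_le_walkIdeal K G) (walkIdeal_le_toricIdeal K G)
end

section
/- Let G be a finite connected simple graph. Then I_G = (0) if and only if G has at most one cycle and every cycle of G (if any) is odd. -/
set_option linter.unusedVariables false

open MvPolynomial

universe uv

/-- `c` describes a cycle of length `q` in `G`: `q ≥ 3`, the vertices
`c 0, …, c (q-1)` are pairwise distinct, and cyclically consecutive vertices
are adjacent. -/
def IsCycleOn' {V : Type*} (G : SimpleGraph V) (q : ℕ) (c : ZMod q → V) : Prop :=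
  3 ≤ q ∧ Function.Injective c ∧ ∀ i, G.Adj (c i) (c (i + 1))

/-- The set of edges of the cycle described by `c`. -/
def cycEdges {V : Type*} (q : ℕ) (c : ZMod q → V) : Set (Sym2 V) :=
  { e | ∃ i, e = s(c i, c (i + 1)) }

/-- The set of vertices of the cycle described by `c`. -/
def cycVerts {V : Type*} (q : ℕ) (c : ZMod q → V) : Set V := Set.range c

/-- `e` is a chord of the cycle `c` in `G`: an edge of `G` joining two vertices of
the cycle which is not an edge of the cycle. -/
def IsChord {V : Type*} (G : SimpleGraph V) (q : ℕ) (c : ZMod q → V) (e : Sym2 V) : Prop :=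
  e ∈ G.edgeSet ∧ e ∉ cycEdges q c ∧ ∃ i j : ZMod q, e = s(c i, c j)

/-- The incidence vector `δ_a + δ_b` of an edge `{a,b}`. -/
noncomputable def incVec {V : Type*} (R : Type*) [Semiring R] (e : Sym2 V) : V →₀ R :=
  Sym2.lift ⟨fun a b => Finsupp.single a 1 + Finsupp.single b 1, fun _ _ => add_comm _ _⟩ e

@[simp]
lemma incVec_mk {V : Type*} (R : Type*) [Semiring R] (a b : V) :
    incVec R s(a, b) = Finsupp.single a 1 + Finsupp.single b 1 := rfl

lemma edgeMon_eq_monomial {V : Type*} (K : Type*) [Field K] (e : Sym2 V) :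
    edgeMon K e = monomial (incVec ℕ e) 1 := by
  induction e with
  | h a b => simp [edgeMon, X, monomial_mul]

lemma aeval_edgeMon_monomial_s1 {V : Type*} (K : Type*) [Field K] (G : SimpleGraph V)
    (u : G.edgeSet →₀ ℕ) (r : K) :
    aeval (R := K) (fun e : G.edgeSet => edgeMon K e.1) (monomial u r) =
      monomial (Finsupp.linearCombination ℕ (fun e : G.edgeSet => incVec ℕ e.1) u) r := by
  rw [aeval_monomial, Finsupp.linearCombination_apply, Finsupp.sum, Finsupp.prod]
  simp only [edgeMon_eq_monomial, monomial_pow, one_pow]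
  rw [← monomial_sum_one, algebraMap_eq, C_mul_monomial, mul_one]

lemma toricIdeal_eq_bot_iff_linearIndependent_nat {V : Type*} (K : Type*) [Field K]
    (G : SimpleGraph V) :
    toricIdeal K G = ⊥ ↔ LinearIndependent ℕ (fun e : G.edgeSet => incVec ℕ e.1) := by
  rw [toricIdeal, RingHom.ker_eq_bot_iff_eq_zero, ← injective_iff_map_eq_zero]
  constructor
  · intro h u w huw
    have := @h (monomial u 1) (monomial w 1) (by
      simp only [aeval_edgeMon_monomial_s1, huw])
    exact monomial_left_injective one_ne_zero this
  · intro h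
    have key : aeval (R := K) (fun e : G.edgeSet => edgeMon K e.1) =
        AddMonoidAlgebra.mapDomainAlgHom K K
          (Finsupp.linearCombination ℕ
            (fun e : G.edgeSet => incVec ℕ e.1)).toAddMonoidHom := by
      apply MvPolynomial.algHom_ext
      intro e
      rw [X, aeval_edgeMon_monomial_s1, AddMonoidAlgebra.mapDomainAlgHom_apply]
      exact (AddMonoidAlgebra.mapDomain_single ..).symm
    rw [key]
    exact AddMonoidAlgebra.mapDomain_injective h

lemma linearIndependent_nat_iff_int {ι M : Type*} [AddCommGroup M] (v : ι → M) :
    LinearIndependent ℕ v ↔ LinearIndependent ℤ v := by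
  constructor
  · intro h
    rw [linearIndependent_iff]
    intro w hw
    have e : w.mapRange Int.toNat rfl = (-w).mapRange Int.toNat rfl := by
      apply h
      rw [← sub_eq_zero, ← hw]
      have hl : ∀ u : ι →₀ ℕ, Finsupp.linearCombination ℕ v u =
          Finsupp.linearCombination ℤ v (u.mapRange (fun n : ℕ => (n : ℤ)) rfl) := by
        intro u
        rw [Finsupp.linearCombination_apply, Finsupp.linearCombination_apply,
          Finsupp.sum_mapRange_index (by simp)]
        simp
      rw [hl, hl, ← map_sub]
      congr 1
      ext i
      simp
    ext i
    have := DFunLike.congr_fun e i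
    simp at this ⊢
    omega
  · intro h
    exact h.restrict_scalars (R := ℕ) (by
      intro a b hab
      simpa using hab)

/-- The toric ideal vanishes iff the incidence vectors of the edges are linearly independent. -/
lemma toricIdeal_eq_bot_iff_linearIndependent {V : Type*} (K : Type*) [Field K]
    (G : SimpleGraph V) :
    toricIdeal K G = ⊥ ↔ LinearIndependent ℚ (fun e : G.edgeSet => incVec ℚ e.1) := by
  rw [toricIdeal_eq_bot_iff_linearIndependent_nat, ← LinearIndependent.iff_fractionRing ℤ ℚ,
    ← linearIndependent_nat_iff_int]
  let f : (V →₀ ℕ) →ₗ[ℕ] (V →₀ ℚ) :=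
    Finsupp.mapRange.linearMap (Nat.castAddMonoidHom ℚ).toNatLinearMap
  have hf : Function.Injective f :=
    Finsupp.mapRange_injective _ (by simp) Nat.cast_injective
  have hv : (fun e : G.edgeSet => incVec ℚ e.1) = f ∘ fun e : G.edgeSet => incVec ℕ e.1 := by
    funext ⟨e, he⟩
    induction e with
    | h a b => simp [f, Finsupp.mapRange_add]
  rw [hv, LinearMap.linearIndependent_iff_of_injOn f hf.injOn]

lemma IsCycleOn'.edge_injective {V : Type*} {G : SimpleGraph V} {q : ℕ} {c : ZMod q → V}
    (h : IsCycleOn' G q c) : Function.Injective fun i => s(c i, c (i + 1)) := by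
  obtain ⟨hq, hc, -⟩ := h
  intro i j hij
  simp only [Sym2.eq_iff] at hij
  rcases hij with ⟨h1, -⟩ | ⟨h1, h2⟩
  · exact hc h1
  · have h1 := hc h1
    have h2 := hc h2
    have h3 : ((2 : ℕ) : ZMod q) = 0 := by
      rw [h1, add_assoc, add_eq_left] at h2
      push_cast
      rw [← h2]
      norm_num
    rw [ZMod.natCast_eq_zero_iff] at h3
    have := Nat.le_of_dvd (by norm_num) h3
    omega

lemma ZMod.exists_alternating {q : ℕ} (hq : Even q) :
    ∃ ε : ZMod q → ℚ, ε 0 ≠ 0 ∧ ∀ i, ε (i + 1) = -ε i := by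
  refine ⟨fun i => if ZMod.castHom hq.two_dvd (ZMod 2) i = 0 then 1 else -1, by simp, ?_⟩
  intro i
  simp only [map_add, map_one]
  have h2 : ∀ x : ZMod 2, x + 1 = 0 ↔ ¬ x = 0 := by decide
  simp only [h2]
  split_ifs <;> simp

/-- The incidence vectors along an even cycle are linearly dependent. -/
lemma IsCycleOn'.odd_of_linearIndependent {V : Type*} {G : SimpleGraph V} {q : ℕ}
    {c : ZMod q → V} (h : IsCycleOn' G q c)
    (hG : LinearIndependent ℚ (fun e : G.edgeSet => incVec ℚ e.1)) : Odd q := by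
  by_contra hodd
  rw [Nat.not_odd_iff_even] at hodd
  obtain ⟨ε, h0, hε⟩ := ZMod.exists_alternating hodd
  have : NeZero q := ⟨by have := h.1; omega⟩
  have hli := hG.comp (fun i : ZMod q => (⟨s(c i, c (i + 1)), h.2.2 i⟩ : G.edgeSet))
    (fun i j hij => h.edge_injective (Subtype.ext_iff.mp hij))
  rw [Fintype.linearIndependent_iff] at hli
  refine h0 (hli ε ?_ 0)
  simp only [Function.comp_def, incVec_mk, smul_add, Finset.sum_add_distrib]
  rw [← Equiv.sum_comp (Equiv.addRight (1 : ZMod q)), ← Finset.sum_add_distrib]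
  refine Finset.sum_eq_zero fun i _ => ?_
  simp [hε]

lemma IsCycleOn'.not_isBridge {V : Type*} {G : SimpleGraph V} {q : ℕ} {c : ZMod q → V}
    (h : IsCycleOn' G q c) (i : ZMod q) : ¬ G.IsBridge s(c i, c (i + 1)) := by
  rw [SimpleGraph.isBridge_iff, not_not]
  have key : ∀ k : ℕ, k < q →
      (G.deleteEdges {s(c i, c (i + 1))}).Reachable (c (i + 1)) (c (i + 1 + k)) := by
    intro k
    induction k with
    | zero => intro _; simp
    | succ k ih =>
      intro hk
      refine (ih (by omega)).trans (SimpleGraph.Adj.reachable ?_)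
      rw [SimpleGraph.deleteEdges_adj]
      have hadj := h.2.2 (i + 1 + k)
      refine ⟨by simpa [add_assoc] using hadj, ?_⟩
      intro hmem
      have := @IsCycleOn'.edge_injective _ _ _ _ h (i + 1 + k) i
        (by simpa [add_assoc] using hmem)
      have h0 : ((k + 1 : ℕ) : ZMod q) = 0 := by
        push_cast
        rw [add_assoc, add_eq_left] at this
        rw [← this, add_comm]
      rw [ZMod.natCast_eq_zero_iff] at h0
      have := Nat.le_of_dvd (by omega) h0
      omega
  have hq := h.1
  have hk := key (q - 1) (by omega)
  have : (i + 1 + ((q - 1 : ℕ) : ZMod q)) = i := by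
    rw [Nat.cast_sub (by omega)]
    simp
  rw [this] at hk
  exact hk.symm

lemma exists_isCycleOn'_of_not_isAcyclic {V : Type*} {G : SimpleGraph V}
    (h : ¬ G.IsAcyclic) : ∃ (q : ℕ) (c : ZMod q → V), IsCycleOn' G q c := by
  rw [SimpleGraph.isAcyclic_iff_free_cycleGraph] at h
  push Not at h
  obtain ⟨n, hn, hf⟩ := h
  obtain ⟨f⟩ := hf
  obtain ⟨m, rfl⟩ : ∃ m, n = m + 3 := ⟨n - 3, by omega⟩
  have hadj : ∀ i : Fin (m + 3), (SimpleGraph.cycleGraph (m + 3)).Adj i (i + 1) := fun i => by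
    rw [SimpleGraph.cycleGraph_adj]
    exact Or.inr (add_sub_cancel_left i 1)
  exact ⟨m + 3, f, hn, f.injective, fun i => f.toHom.map_adj (hadj i)⟩

lemma SimpleGraph.Connected.eq_top_of_single_mem {V : Type*} {G : SimpleGraph V}
    (hG : G.Connected) (W : Submodule ℚ (V →₀ ℚ)) (r : V) (hr : Finsupp.single r 1 ∈ W)
    (hW : ∀ e ∈ G.edgeSet, incVec ℚ e ∈ W) : W = ⊤ := by
  have hall : ∀ v, Finsupp.single v (1 : ℚ) ∈ W := by
    intro v
    obtain ⟨p⟩ := hG.preconnected r v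
    induction p with
    | nil => exact hr
    | @cons a b _ hab _ ih =>
      refine ih ?_
      have := hW s(a, b) hab
      rw [incVec_mk] at this
      exact (W.add_mem_iff_right hr).mp this
  refine W.eq_top_iff'.mpr fun f => ?_
  rw [← f.sum_single]
  refine W.sum_mem fun v _ => ?_
  simpa using W.smul_mem (f v) (hall v)

lemma IsCycleOn'.single_mem_of_odd {V : Type*} {G : SimpleGraph V} {q : ℕ} {c : ZMod q → V}
    (h : IsCycleOn' G q c) (hq : Odd q) (W : Submodule ℚ (V →₀ ℚ))
    (hW : ∀ e ∈ G.edgeSet, incVec ℚ e ∈ W) : Finsupp.single (c 0) 1 ∈ W := by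
  have key : ∀ k : ℕ,
      Finsupp.single (c k) (1 : ℚ) - (-1 : ℚ) ^ k • Finsupp.single (c 0) (1 : ℚ) ∈ W := by
    intro k
    induction k with
    | zero => simp
    | succ k ih =>
      have h1 := hW s(c k, c (k + 1)) (h.2.2 k)
      rw [incVec_mk] at h1
      convert W.sub_mem h1 ih using 1
      rw [pow_succ, Nat.cast_succ]
      module
  have h2 := key q
  rw [hq.neg_one_pow, ZMod.natCast_self] at h2
  convert W.smul_mem (1 / 2 : ℚ) h2 using 1
  module

lemma SimpleGraph.card_edgeSet_deleteEdges_singleton {V : Type*} [Finite V] {G : SimpleGraph V}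
    {e : Sym2 V} (he : e ∈ G.edgeSet) :
    Nat.card (G.deleteEdges {e}).edgeSet + 1 = Nat.card G.edgeSet := by
  rw [SimpleGraph.edgeSet_deleteEdges, Nat.card_coe_set_eq, Nat.card_coe_set_eq]
  exact Set.ncard_sdiff_singleton_add_one he (Set.toFinite _)

/-- In a connected graph with at most as many edges as vertices, every edge of a cycle belongs
to every other cycle. -/
lemma cycEdges_subset_of_card_le {V : Type*} [Finite V] {G : SimpleGraph V} (hG : G.Connected)
    (hcard : Nat.card G.edgeSet ≤ Nat.card V) {q₁ q₂ : ℕ} {c₁ : ZMod q₁ → V} {c₂ : ZMod q₂ → V}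
    (h₁ : IsCycleOn' G q₁ c₁) (h₂ : IsCycleOn' G q₂ c₂) : cycEdges q₁ c₁ ⊆ cycEdges q₂ c₂ := by
  rintro e ⟨i, rfl⟩
  by_contra hmem
  have hconn := hG.connected_delete_edge_of_not_isBridge (h₁.not_isBridge i)
  have hc := SimpleGraph.card_edgeSet_deleteEdges_singleton (e := s(c₁ i, c₁ (i + 1))) (h₁.2.2 i)
  have hle := hconn.card_vert_le_card_edgeSet_add_one
  have htree := SimpleGraph.isTree_iff_connected_and_card.mpr ⟨hconn, by omega⟩
  have h₂' : IsCycleOn' (G.deleteEdges {s(c₁ i, c₁ (i + 1))}) q₂ c₂ := by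
    refine ⟨h₂.1, h₂.2.1, fun j => ?_⟩
    rw [SimpleGraph.deleteEdges_adj]
    exact ⟨h₂.2.2 j, fun hj => hmem ⟨j, (Set.mem_singleton_iff.mp hj).symm⟩⟩
  exact h₂'.not_isBridge 0
    (SimpleGraph.isAcyclic_iff_forall_adj_isBridge.mp htree.isAcyclic (h₂'.2.2 0))

lemma SimpleGraph.IsTree.linearIndependent_incVec {V : Type*} [Finite V] {G : SimpleGraph V}
    (hG : G.IsTree) : LinearIndependent ℚ (fun e : G.edgeSet => incVec ℚ e.1) := by
  have := Fintype.ofFinite V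
  have := Fintype.ofFinite G.edgeSet
  obtain ⟨r⟩ := hG.connected.nonempty
  have hcard := (SimpleGraph.isTree_iff_connected_and_card.mp hG).2
  let b : Option G.edgeSet → (V →₀ ℚ) := fun o => o.elim (Finsupp.single r 1) (incVec ℚ ·.1)
  have hb : LinearIndependent ℚ b := by
    refine linearIndependent_of_top_le_span_of_card_eq_finrank (top_le_iff.mpr ?_) ?_
    · exact hG.connected.eq_top_of_single_mem _ r (Submodule.subset_span ⟨none, rfl⟩)
        fun e he => Submodule.subset_span ⟨some ⟨e, he⟩, rfl⟩
    · rw [Fintype.card_option, Module.finrank_finsupp_self, ← Nat.card_eq_fintype_card,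
        ← Nat.card_eq_fintype_card, hcard]
  exact hb.comp some (Option.some_injective _)

/-- A connected graph with an odd cycle and as many edges as vertices has linearly independent
incidence vectors. -/
lemma IsCycleOn'.linearIndependent_incVec {V : Type*} [Finite V] {G : SimpleGraph V}
    (hG : G.Connected) {q : ℕ} {c : ZMod q → V} (h : IsCycleOn' G q c) (hq : Odd q)
    (hcard : Nat.card G.edgeSet = Nat.card V) :
    LinearIndependent ℚ (fun e : G.edgeSet => incVec ℚ e.1) := by
  have := Fintype.ofFinite V
  have := Fintype.ofFinite G.edgeSet
  refine linearIndependent_of_top_le_span_of_card_eq_finrank (top_le_iff.mpr ?_) ?_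
  · have hW : ∀ e ∈ G.edgeSet, incVec ℚ e ∈
        Submodule.span ℚ (Set.range fun e : G.edgeSet => incVec ℚ e.1) :=
      fun e he => Submodule.subset_span ⟨⟨e, he⟩, rfl⟩
    exact hG.eq_top_of_single_mem _ (c 0) (h.single_mem_of_odd hq _ hW) hW
  · rw [Module.finrank_finsupp_self, ← Nat.card_eq_fintype_card, ← Nat.card_eq_fintype_card,
      hcard]

/-- `I_G = (0)` if and only if `G` has at most one cycle and every cycle of `G`
(if any) is odd. -/
theorem toricIdeal_eq_bot_iff {V : Type*} [Fintype V] (K : Type*) [Field K]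
    (G : SimpleGraph V) (hG : G.Connected) :
    toricIdeal K G = ⊥ ↔
      ((∀ (q₁ : ℕ) (c₁ : ZMod q₁ → V) (q₂ : ℕ) (c₂ : ZMod q₂ → V),
          IsCycleOn' G q₁ c₁ → IsCycleOn' G q₂ c₂ → cycEdges q₁ c₁ = cycEdges q₂ c₂) ∧
        (∀ (q : ℕ) (c : ZMod q → V), IsCycleOn' G q c → Odd q)) := by
  rw [toricIdeal_eq_bot_iff_linearIndependent]
  constructor
  · intro h
    have := Fintype.ofFinite G.edgeSet
    have hcard : Nat.card G.edgeSet ≤ Nat.card V := by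
      simpa using h.fintype_card_le_finrank
    exact ⟨fun q₁ c₁ q₂ c₂ h₁ h₂ => (cycEdges_subset_of_card_le hG hcard h₁ h₂).antisymm
      (cycEdges_subset_of_card_le hG hcard h₂ h₁), fun q c hc => hc.odd_of_linearIndependent h⟩
  · rintro ⟨huniq, hodd⟩
    by_cases hac : G.IsAcyclic
    · exact SimpleGraph.IsTree.linearIndependent_incVec ⟨hG, hac⟩
    obtain ⟨q, c, hc⟩ := exists_isCycleOn'_of_not_isAcyclic hac
    refine hc.linearIndependent_incVec hG (hodd q c hc) ?_
    have hconn := hG.connected_delete_edge_of_not_isBridge (hc.not_isBridge 0)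
    have hacyc : (G.deleteEdges {s(c 0, c (0 + 1))}).IsAcyclic := by
      by_contra hcyc
      obtain ⟨q', c', hc'⟩ := exists_isCycleOn'_of_not_isAcyclic hcyc
      have hmem : s(c 0, c (0 + 1)) ∈ cycEdges q' c' := by
        rw [← huniq q c q' c' hc
          ⟨hc'.1, hc'.2.1, fun i => SimpleGraph.deleteEdges_le _ (hc'.2.2 i)⟩]
        exact ⟨0, rfl⟩
      obtain ⟨i, hi⟩ := hmem
      exact ((SimpleGraph.deleteEdges_adj ..).mp (hc'.2.2 i)).2 hi.symm
    rw [← (SimpleGraph.isTree_iff_connected_and_card.mp ⟨hconn, hacyc⟩).2,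
      SimpleGraph.card_edgeSet_deleteEdges_singleton (e := s(c 0, c (0 + 1))) (hc.2.2 0)]
end
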